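/- arXiv:1312.2606 — 2 statements merged into one kernel-verified Lean document; each statement's English description precedes it below -/
import Mathlib

section
/- Suppose ‖φ_{m,t}^i‖ ≤ 1 for all m = 1,…,M, t = 1,…,T, i = 1,…,N. Then for every s > 1 (so that s* = s/(s−1) is finite) and every r ≥ 1, R̂(F_{s,r}) ≤ (2/(T√N)) · √( R · s* · T^{2/s*} · M^{max{1/r*, 2/s*}} ), where 1/r* = 1 − 1/r. -/
open scoped BigOperators
open RealInnerProductSpace

noncomputable section

/-- The sign `+1`/`-1` associated with a Boolean, used to realize Rademacher variables. -/
def sgn (b : Bool) : ℝ := if b then 1 else -1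

/-- Expectation over i.i.d. Rademacher variables `σ_t^i` (`t = 1,…,T`, `i = 1,…,N`),
realized as the uniform average over all sign patterns. -/
def Eσ (T N : ℕ) (f : (Fin T → Fin N → Bool) → ℝ) : ℝ :=
  (∑ σ : Fin T → Fin N → Bool, f σ) / (Fintype.card (Fin T → Fin N → Bool) : ℝ)

/-- Admissibility of a triple `(w, θ, λ)` for the multi-kernel hypothesis class `F_{s,r}`:
`θ ⪰ 0` with `‖θ‖_r ≤ 1`, `λ ⪰ 0` with `‖λ‖_s ≤ 1`, and `Σ_m ‖w_t^m‖² ≤ λ_t² R` for all `t`. -/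
def MKadm {M T : ℕ} (H : Fin M → Type*) [∀ m, NormedAddCommGroup (H m)]
    [∀ m, InnerProductSpace ℝ (H m)] (s r R : ℝ)
    (w : Fin T → ∀ m, H m) (θ : Fin M → ℝ) (lam : Fin T → ℝ) : Prop :=
  (∀ m, 0 ≤ θ m) ∧ (∑ m, θ m ^ r) ≤ 1 ∧
    (∀ t, 0 ≤ lam t) ∧ (∑ t, lam t ^ s) ≤ 1 ∧
    ∀ t, (∑ m, ‖w t m‖ ^ 2) ≤ lam t ^ 2 * R

/-- Empirical Rademacher complexity of the multi-kernel hypothesis class `F_{s,r}`, with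
respect to the sampled feature vectors `φ_{m,t}^i`. -/
def ERCmk {M : ℕ} (H : Fin M → Type*) [∀ m, NormedAddCommGroup (H m)]
    [∀ m, InnerProductSpace ℝ (H m)] (T N : ℕ)
    (φ : ∀ m, Fin T → Fin N → H m) (s r R : ℝ) : ℝ :=
  Eσ T N (fun σ => sSup {v : ℝ |
    ∃ (w : Fin T → ∀ m, H m) (θ : Fin M → ℝ) (lam : Fin T → ℝ),
      MKadm H s r R w θ lam ∧
      v = (2 / ((T : ℝ) * N)) *
        ∑ t, ∑ i, sgn (σ t i) * ∑ m, Real.sqrt (θ m) * ⟪w t m, φ m t i⟫})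

/-! ### Auxiliary lemmas -/

lemma aux_pow_sym (a c d : ℝ) (hc : |c| ≤ d) (hd : d ≤ a) (k : ℕ) :
    (a + c) ^ k + (a - c) ^ k ≤ (a + d) ^ k + (a - d) ^ k := by
  have hd0 : 0 ≤ d := (abs_nonneg c).trans hc
  obtain ⟨h1, h2⟩ := abs_le.mp hc
  rcases hd0.eq_or_lt with h0 | h0
  · have : c = 0 := by apply le_antisymm <;> linarith
    subst this; subst h0; simp
  · have hconv := (convexOn_pow (𝕜 := ℝ) k).2
    have hA : (a + d) ∈ Set.Ici (0 : ℝ) := by simp; linarith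
    have hB : (a - d) ∈ Set.Ici (0 : ℝ) := by simp; linarith
    have e1 : 0 ≤ (d + c) / (2 * d) := by apply div_nonneg <;> linarith
    have e2 : 0 ≤ (d - c) / (2 * d) := by apply div_nonneg <;> linarith
    have e3 : (d + c) / (2 * d) + (d - c) / (2 * d) = 1 := by field_simp; ring
    have i1 := hconv hA hB e1 e2 e3
    have i2 := hconv hA hB e2 e1 (by rw [add_comm]; exact e3)
    simp only [smul_eq_mul] at i1 i2
    have j1 : (d + c) / (2 * d) * (a + d) + (d - c) / (2 * d) * (a - d) = a + c := by
      field_simp; ring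
    have j2 : (d - c) / (2 * d) * (a + d) + (d + c) / (2 * d) * (a - d) = a - c := by
      field_simp; ring
    rw [j1] at i1
    rw [j2] at i2
    have : (d - c) / (2 * d) = 1 - (d + c) / (2 * d) := by linarith
    rw [this] at i1 i2
    linarith

lemma aux_cosh_two {V : Type*} [NormedAddCommGroup V] [InnerProductSpace ℝ V]
    (l : ℝ) (x y : V) :
    Real.cosh (l * ‖x + y‖) + Real.cosh (l * ‖x - y‖) ≤
      2 * (Real.cosh (l * ‖x‖) * Real.cosh (l * ‖y‖)) := by
  have h : 2 * (Real.cosh (l * ‖x‖) * Real.cosh (l * ‖y‖)) =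
      Real.cosh (l * (‖x‖ + ‖y‖)) + Real.cosh (l * (‖x‖ - ‖y‖)) := by
    rw [mul_add, mul_sub, Real.cosh_add, Real.cosh_sub]; ring
  rw [h]
  refine hasSum_le ?_ ((Real.hasSum_cosh (l * ‖x + y‖)).add (Real.hasSum_cosh (l * ‖x - y‖)))
    ((Real.hasSum_cosh (l * (‖x‖ + ‖y‖))).add (Real.hasSum_cosh (l * (‖x‖ - ‖y‖))))
  intro n
  rw [← add_div, ← add_div]
  apply div_le_div_of_nonneg_right _ (by positivity)
  have key := aux_pow_sym (‖x‖ ^ 2 + ‖y‖ ^ 2) (2 * ⟪x, y⟫) (2 * (‖x‖ * ‖y‖))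
    (by rw [abs_mul, abs_two]; linarith [abs_real_inner_le_norm x y])
    (by nlinarith [sq_nonneg (‖x‖ - ‖y‖)]) n
  have e1 : ‖x‖ ^ 2 + ‖y‖ ^ 2 + 2 * ⟪x, y⟫ = ‖x + y‖ ^ 2 := by
    rw [norm_add_sq_real]; ring
  have e2 : ‖x‖ ^ 2 + ‖y‖ ^ 2 - 2 * ⟪x, y⟫ = ‖x - y‖ ^ 2 := by
    rw [norm_sub_sq_real]; ring
  have e3 : ‖x‖ ^ 2 + ‖y‖ ^ 2 + 2 * (‖x‖ * ‖y‖) = (‖x‖ + ‖y‖) ^ 2 := by ring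
  have e4 : ‖x‖ ^ 2 + ‖y‖ ^ 2 - 2 * (‖x‖ * ‖y‖) = (‖x‖ - ‖y‖) ^ 2 := by ring
  rw [e1, e2, e3, e4] at key
  simp only [mul_pow l, ← mul_add]
  apply mul_le_mul_of_nonneg_left _ (by rw [pow_mul]; positivity)
  simpa only [pow_mul] using key

lemma aux_sum_succ {n : ℕ} (f : (Fin (n + 1) → Bool) → ℝ) :
    ∑ σ, f σ = ∑ σ : Fin n → Bool, (f (Fin.cons true σ) + f (Fin.cons false σ)) := by
  rw [← (Fin.consEquiv (fun _ : Fin (n + 1) => Bool)).sum_comp, Fintype.sum_prod_type,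
    Fintype.sum_bool, ← Finset.sum_add_distrib]
  rfl

lemma aux_cosh_sum {V : Type*} [NormedAddCommGroup V] [InnerProductSpace ℝ V]
    (l : ℝ) (n : ℕ) (φ : Fin n → V) (hφ : ∀ i, ‖φ i‖ ≤ 1) (x : V) :
    ∑ σ : Fin n → Bool, Real.cosh (l * ‖x + ∑ i, sgn (σ i) • φ i‖) ≤
      2 ^ n * (Real.cosh (l * ‖x‖) * Real.cosh l ^ n) := by
  induction n generalizing x with
  | zero => simp
  | succ n ih =>
    rw [aux_sum_succ, Finset.sum_add_distrib]
    simp only [Fin.sum_univ_succ, Fin.cons_zero, Fin.cons_succ, ← add_assoc]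
    have h1 := ih (fun i => φ i.succ) (fun i => hφ _) (x + sgn true • φ 0)
    have h2 := ih (fun i => φ i.succ) (fun i => hφ _) (x + sgn false • φ 0)
    refine (add_le_add h1 h2).trans ?_
    have e1 : x + sgn true • φ 0 = x + φ 0 := by simp [sgn]
    have e2 : x + sgn false • φ 0 = x - φ 0 := by simp [sgn, sub_eq_add_neg]
    rw [e1, e2]
    have h3 := aux_cosh_two l x (φ 0)
    have h4 : Real.cosh (l * ‖φ 0‖) ≤ Real.cosh l := by
      rw [Real.cosh_le_cosh, abs_mul, abs_norm]
      exact mul_le_of_le_one_right (abs_nonneg _) (hφ 0)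
    have h5 : Real.cosh (l * ‖x‖) * Real.cosh (l * ‖φ 0‖) ≤
        Real.cosh (l * ‖x‖) * Real.cosh l :=
      mul_le_mul_of_nonneg_left h4 (Real.cosh_pos _).le
    have h6 : (0 : ℝ) ≤ 2 ^ n * Real.cosh l ^ n := by
      have := (Real.cosh_pos l).le
      positivity
    have h7 := mul_le_mul_of_nonneg_left (h3.trans (mul_le_mul_of_nonneg_left h5 zero_le_two)) h6
    calc _ = 2 ^ n * Real.cosh l ^ n * (Real.cosh (l * ‖x + φ 0‖) + Real.cosh (l * ‖x - φ 0‖)) := by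
          ring
      _ ≤ _ := h7
      _ = _ := by ring

lemma aux_sq_sum {V : Type*} [NormedAddCommGroup V] [InnerProductSpace ℝ V]
    (n : ℕ) (φ : Fin n → V) (hφ : ∀ i, ‖φ i‖ ≤ 1) (x : V) :
    ∑ σ : Fin n → Bool, ‖x + ∑ i, sgn (σ i) • φ i‖ ^ 2 ≤ 2 ^ n * (‖x‖ ^ 2 + n) := by
  induction n generalizing x with
  | zero => simp
  | succ n ih =>
    rw [aux_sum_succ, Finset.sum_add_distrib]
    simp only [Fin.sum_univ_succ, Fin.cons_zero, Fin.cons_succ, ← add_assoc]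
    have h1 := ih (fun i => φ i.succ) (fun i => hφ _) (x + sgn true • φ 0)
    have h2 := ih (fun i => φ i.succ) (fun i => hφ _) (x + sgn false • φ 0)
    refine (add_le_add h1 h2).trans ?_
    have e1 : x + sgn true • φ 0 = x + φ 0 := by simp [sgn]
    have e2 : x + sgn false • φ 0 = x - φ 0 := by simp [sgn, sub_eq_add_neg]
    rw [e1, e2, norm_add_sq_real, norm_sub_sq_real]
    have h4 : ‖φ 0‖ ^ 2 ≤ 1 := pow_le_one₀ (norm_nonneg _) (hφ 0)
    have h5 := mul_le_mul_of_nonneg_left h4 (by positivity : (0 : ℝ) ≤ 2 ^ n)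
    push_cast
    rw [pow_succ (2 : ℝ) n]
    linarith

lemma aux_khintchine {V : Type*} [NormedAddCommGroup V] [InnerProductSpace ℝ V]
    (n : ℕ) (hn : 0 < n) (φ : Fin n → V) (hφ : ∀ i, ‖φ i‖ ≤ 1) (q : ℝ) (hq : 1 < q) :
    ∑ σ : Fin n → Bool, ‖∑ i, sgn (σ i) • φ i‖ ^ q ≤ 2 ^ n * Real.sqrt (q * n) ^ q := by
  have hn' : (0 : ℝ) < n := by exact_mod_cast hn
  have hn1 : (1 : ℝ) ≤ n := by exact_mod_cast hn
  have hcard : ∑ _σ : Fin n → Bool, (1 : ℝ) = 2 ^ n := by simp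
  rcases le_total q 2 with h2 | h2
  · have hs := aux_sq_sum n φ hφ 0
    simp only [zero_add, norm_zero] at hs
    have step : ∀ y : ℝ, 0 ≤ y → y ^ q ≤ Real.sqrt n ^ q * (1 + q / 2 * (y ^ 2 / n - 1)) := by
      intro y hy
      have b := rpow_one_add_le_one_add_mul_self (s := y ^ 2 / n - 1)
        (by have : 0 ≤ y ^ 2 / n := by positivity
            linarith) (p := q / 2) (by linarith) (by linarith)
      have e : (1 + (y ^ 2 / n - 1) : ℝ) ^ (q / 2) = y ^ q / Real.sqrt n ^ q := by
        rw [add_sub_cancel, Real.div_rpow (by positivity) hn'.le, Real.sqrt_eq_rpow,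
          ← Real.rpow_mul hn'.le, ← Real.rpow_natCast y 2, ← Real.rpow_mul hy]
        congr 2 <;> (push_cast; ring)
      rw [e, div_le_iff₀ (by positivity)] at b
      linarith
    calc _ ≤ ∑ σ : Fin n → Bool, Real.sqrt n ^ q *
            (1 + q / 2 * (‖∑ i, sgn (σ i) • φ i‖ ^ 2 / n - 1)) :=
          Finset.sum_le_sum fun σ _ => step _ (norm_nonneg _)
      _ = Real.sqrt n ^ q * (2 ^ n + q / 2 *
            ((∑ σ : Fin n → Bool, ‖∑ i, sgn (σ i) • φ i‖ ^ 2) / n - 2 ^ n)) := by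
          rw [← Finset.mul_sum, Finset.sum_add_distrib, ← Finset.mul_sum,
            Finset.sum_sub_distrib, Finset.sum_div, hcard]
      _ ≤ Real.sqrt n ^ q * 2 ^ n := by
          apply mul_le_mul_of_nonneg_left _ (by positivity)
          have : (∑ σ : Fin n → Bool, ‖∑ i, sgn (σ i) • φ i‖ ^ 2) / n ≤ 2 ^ n := by
            rw [div_le_iff₀ hn']; linarith
          nlinarith
      _ ≤ _ := by
          rw [mul_comm]
          apply mul_le_mul_of_nonneg_left _ (by positivity)
          apply Real.rpow_le_rpow (by positivity) _ (by linarith)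
          apply Real.sqrt_le_sqrt
          nlinarith
  · have hq0 : 0 < q := by linarith
    set l := Real.sqrt (q / n) with hl
    have hl2 : l ^ 2 = q / n := Real.sq_sqrt (by positivity)
    have hlpos : 0 < l := Real.sqrt_pos.mpr (by positivity)
    have hlq : Real.sqrt (q * n) * l = q := by
      rw [hl, ← Real.sqrt_mul (by positivity)]
      rw [show q * n * (q / n) = q ^ 2 by field_simp]
      exact Real.sqrt_sq hq0.le
    have step : ∀ y : ℝ, 0 ≤ y →
        y ^ q ≤ Real.sqrt (q * n) ^ q * (2 * Real.exp (-q) * Real.cosh (l * y)) := by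
      intro y hy
      have b := Real.add_one_le_exp (l * y / q - 1)
      have b1 : y ≤ Real.sqrt (q * n) * Real.exp (l * y / q - 1) := by
        have : y = Real.sqrt (q * n) * (l * y / q) := by
          rw [← mul_div_assoc, ← mul_assoc, hlq]; field_simp
        calc y = _ := this
          _ ≤ _ := by
            apply mul_le_mul_of_nonneg_left _ (Real.sqrt_nonneg _)
            linarith
      calc y ^ q ≤ (Real.sqrt (q * n) * Real.exp (l * y / q - 1)) ^ q :=
            Real.rpow_le_rpow hy b1 hq0.le
        _ = Real.sqrt (q * n) ^ q * (Real.exp (-q) * Real.exp (l * y)) := by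
            rw [Real.mul_rpow (Real.sqrt_nonneg _) (Real.exp_pos _).le, ← Real.exp_mul,
              ← Real.exp_add]
            congr 2
            field_simp
            ring
        _ ≤ _ := by
            apply mul_le_mul_of_nonneg_left _ (by positivity)
            have : Real.exp (l * y) ≤ 2 * Real.cosh (l * y) := by
              rw [Real.cosh_eq]
              have := Real.exp_pos (-(l * y))
              linarith
            have := mul_le_mul_of_nonneg_left this (Real.exp_pos (-q)).le
            linarith
    have hc := aux_cosh_sum l n φ hφ 0
    simp only [zero_add, norm_zero, mul_zero, Real.cosh_zero, one_mul] at hc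
    have hc2 : Real.cosh l ^ n ≤ Real.exp (q / 2) := by
      calc Real.cosh l ^ n ≤ Real.exp (l ^ 2 / 2) ^ n :=
            pow_le_pow_left₀ (Real.cosh_pos _).le (Real.cosh_le_exp_half_sq l) n
        _ = Real.exp (q / 2) := by
            rw [← Real.exp_nat_mul, hl2]; congr 1; field_simp
    have hexp : 2 * Real.exp (-q) * Real.exp (q / 2) ≤ 1 := by
      rw [mul_assoc, ← Real.exp_add]
      have h1 : Real.exp (-q + q / 2) ≤ Real.exp (-1) := Real.exp_le_exp.mpr (by linarith)
      have h3 : (2 : ℝ) ≤ Real.exp 1 := by linarith [Real.add_one_le_exp (1 : ℝ)]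
      have h4 : Real.exp (-1) * Real.exp 1 = 1 := by rw [← Real.exp_add]; simp
      nlinarith [Real.exp_pos (-1)]
    calc _ ≤ ∑ σ : Fin n → Bool, Real.sqrt (q * n) ^ q *
            (2 * Real.exp (-q) * Real.cosh (l * ‖∑ i, sgn (σ i) • φ i‖)) :=
          Finset.sum_le_sum fun σ _ => step _ (norm_nonneg _)
      _ = Real.sqrt (q * n) ^ q * (2 * Real.exp (-q) *
            ∑ σ : Fin n → Bool, Real.cosh (l * ‖∑ i, sgn (σ i) • φ i‖)) := by
          rw [← Finset.mul_sum, ← Finset.mul_sum]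
      _ ≤ Real.sqrt (q * n) ^ q * (2 * Real.exp (-q) * (2 ^ n * Real.exp (q / 2))) := by
          gcongr
          exact hc.trans (mul_le_mul_of_nonneg_left hc2 (by positivity))
      _ = Real.sqrt (q * n) ^ q * 2 ^ n * (2 * Real.exp (-q) * Real.exp (q / 2)) := by ring
      _ ≤ Real.sqrt (q * n) ^ q * 2 ^ n * 1 := by gcongr
      _ = _ := by ring

/-- Marginalization of the uniform sign average. -/
lemma aux_marginal (T N : ℕ) (t : Fin T) (g : (Fin N → Bool) → ℝ) (C : ℝ)
    (hg : ∑ x, g x ≤ 2 ^ N * C) : Eσ T N (fun σ => g (σ t)) ≤ C := by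
  classical
  unfold Eσ
  rw [div_le_iff₀ (by exact_mod_cast Fintype.card_pos)]
  have hc := Fintype.card_congr (Equiv.funSplitAt t (Fin N → Bool))
  rw [hc, ← (Equiv.funSplitAt t (Fin N → Bool)).symm.sum_comp, Fintype.sum_prod_type]
  have : ∀ x y, g ((Equiv.funSplitAt t (Fin N → Bool)).symm (x, y) t) = g x := by
    intro x y
    simp [Equiv.funSplitAt, Equiv.piSplitAt]
  simp only [this, Finset.sum_const, nsmul_eq_mul, ← Finset.mul_sum, Fintype.card_prod]
  rw [Finset.card_univ]
  push_cast
  have h2 : (Fintype.card (Fin N → Bool) : ℝ) = 2 ^ N := by simp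
  rw [h2]
  calc _ ≤ (Fintype.card ({j // j ≠ t} → Fin N → Bool) : ℝ) * (2 ^ N * C) := by gcongr
    _ = _ := by ring

lemma aux_theta {M : ℕ} (hM : 0 < M) (r p : ℝ) (hr : 1 ≤ r) (hp : 0 < p)
    (θ Q : Fin M → ℝ) (hθ : ∀ m, 0 ≤ θ m) (hθr : ∑ m, θ m ^ r ≤ 1) (hQ : ∀ m, 0 ≤ Q m) :
    ∑ m, θ m * Q m ≤ (M : ℝ) ^ (max (1 - 1 / r) (1 / p) - 1 / p) *
      (∑ m, Q m ^ p) ^ (1 / p) := by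
  have hr0 : 0 < r := by linarith
  have hθ1 : ∀ m, θ m ≤ 1 := by
    intro m
    have h1 : θ m ^ r ≤ 1 :=
      (Finset.single_le_sum (f := fun m => θ m ^ r)
        (fun i _ => Real.rpow_nonneg (hθ i) r) (Finset.mem_univ m)).trans hθr
    by_contra h
    push Not at h
    exact absurd h1 (not_le.mpr (Real.one_lt_rpow h hr0))
  have hS0 : 0 ≤ ∑ m, Q m ^ p := Finset.sum_nonneg fun m _ => Real.rpow_nonneg (hQ m) p
  have hM1 : (1 : ℝ) ≤ M := by exact_mod_cast hM
  rcases le_or_gt p 1 with hp1 | hp1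
  · have hmax : max (1 - 1 / r) (1 / p) = 1 / p := by
      apply max_eq_right
      have : 1 ≤ 1 / p := by rw [le_div_iff₀ hp]; linarith
      have : 0 < 1 / r := by positivity
      linarith
    rw [hmax, sub_self, Real.rpow_zero, one_mul]
    set S := (∑ m, Q m ^ p) ^ (1 / p) with hS
    have hSn : 0 ≤ S := Real.rpow_nonneg hS0 _
    have hSp : S ^ p = ∑ m, Q m ^ p := by
      rw [hS, ← Real.rpow_mul hS0, one_div_mul_cancel hp.ne', Real.rpow_one]
    have hle : ∀ m, Q m ≤ S := by
      intro m
      rw [← Real.rpow_le_rpow_iff (hQ m) hSn hp, hSp]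
      exact Finset.single_le_sum (f := fun m => Q m ^ p)
        (fun i _ => Real.rpow_nonneg (hQ i) p) (Finset.mem_univ m)
    have hadd : ∀ y : ℝ, 0 ≤ y → y = y ^ p * y ^ (1 - p) := by
      intro y hy
      rw [← Real.rpow_add' hy (by norm_num)]
      simp
    calc ∑ m, θ m * Q m ≤ ∑ m, Q m ^ p * S ^ (1 - p) := by
          apply Finset.sum_le_sum
          intro m _
          calc θ m * Q m ≤ Q m := mul_le_of_le_one_left (hQ m) (hθ1 m)
            _ = Q m ^ p * Q m ^ (1 - p) := hadd _ (hQ m)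
            _ ≤ _ := by
              apply mul_le_mul_of_nonneg_left _ (Real.rpow_nonneg (hQ m) p)
              exact Real.rpow_le_rpow (hQ m) (hle m) (by linarith)
      _ = S ^ p * S ^ (1 - p) := by rw [← Finset.sum_mul, hSp]
      _ = S := (hadd S hSn).symm
  · -- Hoelder
    have hpq : p.HolderConjugate (p / (p - 1)) := .conjExponent hp1
    set p' := p / (p - 1) with hp'
    have hp'0 : 0 < p' := hpq.symm.pos
    have hp'i : 1 / p' = 1 - 1 / p := by rw [hp']; field_simp
    have hH := Real.inner_le_Lp_mul_Lq_of_nonneg Finset.univ hpq.symm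
      (fun m _ => hθ m) (fun m _ => hQ m)
    refine hH.trans ?_
    apply mul_le_mul_of_nonneg_right _ (Real.rpow_nonneg hS0 _)
    have hA0 : 0 ≤ ∑ m, θ m ^ p' := Finset.sum_nonneg fun m _ => Real.rpow_nonneg (hθ m) p'
    rcases le_total (1 - 1 / r) (1 / p) with h | h
    · rw [max_eq_right h, sub_self, Real.rpow_zero]
      have hrp : r ≤ p' := by
        have : 1 / p' ≤ 1 / r := by linarith
        exact (one_div_le_one_div hp'0 hr0).mp this
      apply Real.rpow_le_one hA0 _ (by positivity)
      refine le_trans (Finset.sum_le_sum fun m _ => ?_) hθr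
      exact Real.rpow_le_rpow_of_exponent_ge_of_imp (hθ m) (hθ1 m) hrp
        (fun _ h => absurd h hp'0.ne')
    · rw [max_eq_left h]
      have hrp : p' ≤ r := by
        have : 1 / r ≤ 1 / p' := by linarith
        exact (one_div_le_one_div hr0 hp'0).mp this
      have hu : 1 ≤ r / p' := by rw [le_div_iff₀ hp'0]; linarith
      have hK := Real.rpow_sum_le_const_mul_sum_rpow_of_nonneg (s := Finset.univ)
        (f := fun m => θ m ^ p') hu (fun m _ => Real.rpow_nonneg (hθ m) p')
      have e : ∀ m, (θ m ^ p') ^ (r / p') = θ m ^ r := by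
        intro m
        rw [← Real.rpow_mul (hθ m)]
        congr 1
        field_simp
      simp only [e, Finset.card_univ, Fintype.card_fin] at hK
      have hK2 : (∑ m, θ m ^ p') ^ (r / p') ≤ (M : ℝ) ^ (r / p' - 1) :=
        hK.trans (mul_le_of_le_one_right (by positivity) hθr)
      have hK3 := Real.rpow_le_rpow (Real.rpow_nonneg hA0 _) hK2 (by positivity : 0 ≤ 1 / r)
      rw [← Real.rpow_mul hA0, ← Real.rpow_mul (by positivity)] at hK3
      have e1 : r / p' * (1 / r) = 1 / p' := by field_simp
      have e2 : (r / p' - 1) * (1 / r) = 1 - 1 / r - 1 / p := by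
        rw [sub_mul, e1, hp'i]; ring
      rwa [e1, e2] at hK3

/-- Deterministic bound for a fixed sign pattern. -/
lemma aux_det {M : ℕ} (H : Fin M → Type*) [∀ m, NormedAddCommGroup (H m)]
    [∀ m, InnerProductSpace ℝ (H m)] (T N : ℕ) (hM : 0 < M) (R : ℝ) (hR : 0 < R)
    (φ : ∀ m, Fin T → Fin N → H m) (s q r : ℝ) (hsq : s.HolderConjugate q) (hr : 1 ≤ r)
    (σ : Fin T → Fin N → Bool) (w : Fin T → ∀ m, H m) (θ : Fin M → ℝ) (lam : Fin T → ℝ)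
    (hadm : MKadm H s r R w θ lam) :
    ∑ t, ∑ i, sgn (σ t i) * ∑ m, Real.sqrt (θ m) * ⟪w t m, φ m t i⟫ ≤
      Real.sqrt R * (Real.sqrt ((M : ℝ) ^ (max (1 - 1 / r) (2 / q) - 2 / q)) *
        (∑ t, ∑ m, ‖∑ i, sgn (σ t i) • φ m t i‖ ^ q) ^ (1 / q)) := by
  obtain ⟨hθ, hθr, hl, hls, hw⟩ := hadm
  have hq0 : 0 < q := hsq.symm.pos
  set B := Real.sqrt ((M : ℝ) ^ (max (1 - 1 / r) (2 / q) - 2 / q)) with hB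
  have hB0 : 0 ≤ B := Real.sqrt_nonneg _
  set Y : Fin T → Fin M → ℝ := fun t m => ‖∑ i, sgn (σ t i) • φ m t i‖ with hY
  have hY0 : ∀ t m, 0 ≤ Y t m := fun t m => norm_nonneg _
  have hin0 : ∀ t, 0 ≤ ∑ m, Y t m ^ q := fun t =>
    Finset.sum_nonneg fun m _ => Real.rpow_nonneg (hY0 t m) q
  have h1 : ∀ t, ∑ i, sgn (σ t i) * ∑ m, Real.sqrt (θ m) * ⟪w t m, φ m t i⟫ =
      ∑ m, Real.sqrt (θ m) * ⟪w t m, ∑ i, sgn (σ t i) • φ m t i⟫ := by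
    intro t
    simp only [Finset.mul_sum, inner_sum, inner_smul_right]
    rw [Finset.sum_comm]
    refine Finset.sum_congr rfl fun m _ => Finset.sum_congr rfl fun i _ => ?_
    ring
  have h2 : ∀ t, ∑ m, Real.sqrt (θ m) * ⟪w t m, ∑ i, sgn (σ t i) • φ m t i⟫ ≤
      Real.sqrt R * (B * (lam t * (∑ m, Y t m ^ q) ^ (1 / q))) := by
    intro t
    have a1 : ∑ m, Real.sqrt (θ m) * ⟪w t m, ∑ i, sgn (σ t i) • φ m t i⟫ ≤
        ∑ m, ‖w t m‖ * (Real.sqrt (θ m) * Y t m) := by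
      refine Finset.sum_le_sum fun m _ => ?_
      have := mul_le_mul_of_nonneg_left
        (real_inner_le_norm (w t m) (∑ i, sgn (σ t i) • φ m t i)) (Real.sqrt_nonneg (θ m))
      calc _ ≤ _ := this
        _ = _ := by simp only [hY]; ring
    have a2 := Real.sum_mul_le_sqrt_mul_sqrt Finset.univ (fun m => ‖w t m‖)
      (fun m => Real.sqrt (θ m) * Y t m)
    have a3 : Real.sqrt (∑ m, ‖w t m‖ ^ 2) ≤ lam t * Real.sqrt R := by
      rw [Real.sqrt_le_left (mul_nonneg (hl t) (Real.sqrt_nonneg _)), mul_pow,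
        Real.sq_sqrt hR.le]
      exact hw t
    have a4 : Real.sqrt (∑ m, (Real.sqrt (θ m) * Y t m) ^ 2) ≤
        B * (∑ m, Y t m ^ q) ^ (1 / q) := by
      rw [Real.sqrt_le_left (mul_nonneg hB0 (Real.rpow_nonneg (hin0 t) _)), mul_pow, hB,
        Real.sq_sqrt (by positivity)]
      have b := aux_theta hM r (q / 2) hr (by positivity) θ (fun m => Y t m ^ 2) hθ hθr
        (fun m => by positivity)
      have e1 : ∀ m, (Y t m ^ 2) ^ (q / 2) = Y t m ^ q := by
        intro m
        rw [← Real.rpow_natCast (Y t m) 2, ← Real.rpow_mul (hY0 t m)]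
        congr 1
        push_cast; ring
      have e2 : (1 : ℝ) / (q / 2) = 2 / q := by field_simp
      have e3 : ((∑ m, Y t m ^ q) ^ (1 / q)) ^ 2 = (∑ m, Y t m ^ q) ^ (2 / q) := by
        rw [← Real.rpow_natCast _ 2, ← Real.rpow_mul (hin0 t)]
        congr 1
        push_cast; ring
      simp only [e1, e2] at b
      rw [e3]
      refine le_trans (le_of_eq ?_) b
      refine Finset.sum_congr rfl fun m _ => ?_
      rw [mul_pow, Real.sq_sqrt (hθ m)]
    calc _ ≤ _ := a1.trans a2
      _ ≤ (lam t * Real.sqrt R) * (B * (∑ m, Y t m ^ q) ^ (1 / q)) :=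
        mul_le_mul a3 a4 (Real.sqrt_nonneg _) (mul_nonneg (hl t) (Real.sqrt_nonneg _))
      _ = _ := by ring
  calc _ ≤ ∑ t, Real.sqrt R * (B * (lam t * (∑ m, Y t m ^ q) ^ (1 / q))) := by
        refine Finset.sum_le_sum fun t _ => ?_
        rw [h1]
        exact h2 t
    _ = Real.sqrt R * (B * ∑ t, lam t * (∑ m, Y t m ^ q) ^ (1 / q)) := by
        rw [← Finset.mul_sum, ← Finset.mul_sum]
    _ ≤ _ := by
        apply mul_le_mul_of_nonneg_left _ (Real.sqrt_nonneg _)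
        apply mul_le_mul_of_nonneg_left _ hB0
        have hH := Real.inner_le_Lp_mul_Lq_of_nonneg Finset.univ hsq
          (fun t _ => hl t) (fun t _ => Real.rpow_nonneg (hin0 t) (1 / q))
        have e : ∀ t, ((∑ m, Y t m ^ q) ^ (1 / q)) ^ q = ∑ m, Y t m ^ q := by
          intro t
          rw [← Real.rpow_mul (hin0 t), one_div_mul_cancel hq0.ne', Real.rpow_one]
        simp only [e] at hH
        refine hH.trans ?_
        apply mul_le_of_le_one_left
        · exact Real.rpow_nonneg (Finset.sum_nonneg fun t _ => hin0 t) _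
        · apply Real.rpow_le_one _ hls
          · have := hsq.pos
            positivity
          · exact Finset.sum_nonneg fun t _ => Real.rpow_nonneg (hl t) s

lemma aux_E_mono {T N : ℕ} {f g : (Fin T → Fin N → Bool) → ℝ} (h : ∀ σ, f σ ≤ g σ) :
    Eσ T N f ≤ Eσ T N g := by
  unfold Eσ
  gcongr with σ
  exact h σ

lemma aux_E_mul {T N : ℕ} (c : ℝ) (f : (Fin T → Fin N → Bool) → ℝ) :
    Eσ T N (fun σ => c * f σ) = c * Eσ T N f := by
  unfold Eσ
  rw [← Finset.mul_sum, mul_div_assoc]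

lemma aux_E_sum {T N : ℕ} {ι : Type*} (u : Finset ι) (f : ι → (Fin T → Fin N → Bool) → ℝ) :
    Eσ T N (fun σ => ∑ j ∈ u, f j σ) = ∑ j ∈ u, Eσ T N (f j) := by
  unfold Eσ
  rw [Finset.sum_comm, Finset.sum_div]

lemma aux_E_jensen {T N : ℕ} (q : ℝ) (hq : 1 ≤ q) (f : (Fin T → Fin N → Bool) → ℝ)
    (hf : ∀ σ, 0 ≤ f σ) :
    Eσ T N (fun σ => f σ ^ (1 / q)) ≤ (Eσ T N f) ^ (1 / q) := by
  have hc : (0 : ℝ) < Fintype.card (Fin T → Fin N → Bool) := by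
    exact_mod_cast Fintype.card_pos
  have h := Real.arith_mean_le_rpow_mean Finset.univ
    (fun _ : Fin T → Fin N → Bool => (1 : ℝ) / Fintype.card (Fin T → Fin N → Bool))
    (fun σ => f σ ^ (1 / q)) (fun _ _ => by positivity)
    (by rw [Finset.sum_const, Finset.card_univ, nsmul_eq_mul]; field_simp)
    (fun σ _ => Real.rpow_nonneg (hf σ) _) hq
  have e : ∀ σ, (f σ ^ (1 / q)) ^ q = f σ := by
    intro σ
    rw [← Real.rpow_mul (hf σ), one_div_mul_cancel (by linarith), Real.rpow_one]
  simp only [e, ← Finset.mul_sum] at h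
  unfold Eσ
  rw [one_div_mul_eq_div, one_div_mul_eq_div] at h
  exact h

/-- If `‖φ_{m,t}^i‖ ≤ 1` for all `m, t, i`, then for `s > 1`
(with `s* = s/(s-1)`) and `r ≥ 1` (with `1/r* = 1 - 1/r`),
`R̂(F_{s,r}) ≤ (2/(T√N)) √( R s* T^{2/s*} M^{max{1/r*, 2/s*}} )`. -/
theorem ercmk_bound {M : ℕ} (H : Fin M → Type*) [∀ m, NormedAddCommGroup (H m)]
    [∀ m, InnerProductSpace ℝ (H m)]
    (T N : ℕ) (hT : 0 < T) (hN : 0 < N) (hM : 0 < M) (R : ℝ) (hR : 0 < R)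
    (φ : ∀ m, Fin T → Fin N → H m) (hφ : ∀ m t i, ‖φ m t i‖ ≤ 1)
    (s r : ℝ) (hs : 1 < s) (hr : 1 ≤ r) :
    ERCmk H T N φ s r R ≤
      (2 / ((T : ℝ) * Real.sqrt N)) *
        Real.sqrt (R * (s / (s - 1)) * (T : ℝ) ^ (2 / (s / (s - 1))) *
          (M : ℝ) ^ max (1 - 1 / r) (2 / (s / (s - 1)))) := by
  have hsq : s.HolderConjugate (s / (s - 1)) := .conjExponent hs
  set q := s / (s - 1) with hq
  have hq1 : 1 < q := hsq.symm.lt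
  have hq0 : 0 < q := by linarith
  have hT' : (0 : ℝ) < T := by exact_mod_cast hT
  have hN' : (0 : ℝ) < N := by exact_mod_cast hN
  have hM' : (0 : ℝ) < M := by exact_mod_cast hM
  set a := max (1 - 1 / r) (2 / q) with ha
  set Z : (Fin T → Fin N → Bool) → ℝ := fun σ =>
    ∑ t, ∑ m, ‖∑ i, sgn (σ t i) • φ m t i‖ ^ q with hZ
  have hZ0 : ∀ σ, 0 ≤ Z σ := fun σ => Finset.sum_nonneg fun t _ =>
    Finset.sum_nonneg fun m _ => Real.rpow_nonneg (norm_nonneg _) q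
  set c := 2 / ((T : ℝ) * N) * (Real.sqrt R * Real.sqrt ((M : ℝ) ^ (a - 2 / q))) with hc
  have hc0 : 0 ≤ c := by positivity
  have h1 : ERCmk H T N φ s r R ≤ Eσ T N (fun σ => c * Z σ ^ (1 / q)) := by
    unfold ERCmk
    apply aux_E_mono
    intro σ
    apply Real.sSup_le
    · rintro v ⟨w, θ, lam, hadm, rfl⟩
      have := aux_det H T N hM R hR φ s q r hsq hr σ w θ lam hadm
      rw [hc, mul_assoc, mul_assoc (Real.sqrt R)]
      exact mul_le_mul_of_nonneg_left this (by positivity)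
    · exact mul_nonneg hc0 (Real.rpow_nonneg (hZ0 σ) _)
  have h2 : Eσ T N Z ≤ T * (M * Real.sqrt (q * N) ^ q) := by
    rw [hZ, aux_E_sum]
    calc _ ≤ ∑ _t : Fin T, (M : ℝ) * Real.sqrt (q * N) ^ q := by
          refine Finset.sum_le_sum fun t _ => ?_
          rw [aux_E_sum]
          calc _ ≤ ∑ _m : Fin M, Real.sqrt (q * N) ^ q := by
                refine Finset.sum_le_sum fun m _ => ?_
                exact aux_marginal T N t (fun x => ‖∑ i, sgn (x i) • φ m t i‖ ^ q) _
                  (aux_khintchine N hN (φ m t) (hφ m t) q hq1)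
            _ = _ := by simp
      _ = _ := by simp
  have hEZ0 : 0 ≤ Eσ T N Z := by
    unfold Eσ
    exact div_nonneg (Finset.sum_nonneg fun σ _ => hZ0 σ) (by positivity)
  have h3 : Eσ T N (fun σ => Z σ ^ (1 / q)) ≤
      (T : ℝ) ^ (1 / q) * ((M : ℝ) ^ (1 / q) * Real.sqrt (q * N)) := by
    refine (aux_E_jensen q hq1.le Z hZ0).trans ?_
    refine (Real.rpow_le_rpow hEZ0 h2 (by positivity)).trans (le_of_eq ?_)
    rw [Real.mul_rpow hT'.le (by positivity), Real.mul_rpow hM'.le (by positivity),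
      ← Real.rpow_mul (Real.sqrt_nonneg _), mul_one_div_cancel hq0.ne', Real.rpow_one]
  rw [aux_E_mul] at h1
  refine h1.trans ((mul_le_mul_of_nonneg_left h3 hc0).trans (le_of_eq ?_))
  have eT : Real.sqrt ((T : ℝ) ^ (2 / q)) = (T : ℝ) ^ (1 / q) := by
    rw [Real.sqrt_eq_rpow, ← Real.rpow_mul hT'.le]
    congr 1
    ring
  have eM : Real.sqrt ((M : ℝ) ^ a) =
      Real.sqrt ((M : ℝ) ^ (a - 2 / q)) * (M : ℝ) ^ (1 / q) := by
    rw [Real.sqrt_eq_rpow, Real.sqrt_eq_rpow, ← Real.rpow_mul hM'.le, ← Real.rpow_mul hM'.le,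
      ← Real.rpow_add hM']
    congr 1
    ring
  have eN : Real.sqrt N * Real.sqrt N = N := Real.mul_self_sqrt hN'.le
  have hsN : 0 < Real.sqrt N := Real.sqrt_pos.mpr hN'
  rw [Real.sqrt_mul (by positivity : 0 ≤ R * q * (T : ℝ) ^ (2 / q)),
    Real.sqrt_mul (by positivity : 0 ≤ R * q), Real.sqrt_mul hR.le, eT, eM,
    hc, Real.sqrt_mul hq0.le]
  have eD : 2 / ((T : ℝ) * N) * Real.sqrt N = 2 / ((T : ℝ) * Real.sqrt N) := by
    rw [← eN]
    field_simp
    simp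
  rw [← eD]
  ring

end
end

section
/- Suppose ‖φ_{m,t}^i‖ ≤ 1 for all m, t, i, that MT ≥ 2, and that r ≥ 1 satisfies r* ≥ log(MT) (natural logarithm; r* = ∞ when r = 1). Let ρ = 2 log(MT) and ρ* = ρ/(ρ−1). Then R̂(F_{ρ*, r}) ≤ (2/(T√N)) · √( 2 e R log(MT) ). -/
open scoped BigOperators
open RealInnerProductSpace

noncomputable section

lemma pow_add_pow_le_aux {A B X Y : ℝ} (hA : 0 ≤ A) (h1 : A ≤ X) (h2 : X ≤ B) (h : X + Y = A + B)
    (k : ℕ) : X ^ k + Y ^ k ≤ A ^ k + B ^ k := by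
  rcases eq_or_lt_of_le (h1.trans h2) with hAB | hAB
  · have hX : X = A := by linarith
    have hY : Y = B := by linarith
    rw [hX, hY]
  · have hc := (convexOn_pow (𝕜 := ℝ) k).2
    have hpos : 0 < B - A := by linarith
    set u := (B - X) / (B - A) with hu
    set v := (X - A) / (B - A) with hv
    have hu0 : 0 ≤ u := div_nonneg (by linarith) hpos.le
    have hv0 : 0 ≤ v := div_nonneg (by linarith) hpos.le
    have huv : u + v = 1 := by rw [hu, hv]; field_simp; ring
    have e1 : u * A + v * B = X := by rw [hu, hv]; field_simp; ring
    have e2 : v * A + u * B = Y := by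
      have : u * A + v * B + (v * A + u * B) = A + B := by
        calc _ = (u + v) * (A + B) := by ring
          _ = _ := by rw [huv, one_mul]
      linarith
    have i1 := hc (x := A) hA (y := B) (by simp; linarith) hu0 hv0 huv
    have i2 := hc (x := A) hA (y := B) (by simp; linarith) hv0 hu0 (by linarith)
    simp only [smul_eq_mul] at i1 i2
    rw [e1] at i1
    rw [e2] at i2
    have : u * A ^ k + v * B ^ k + (v * A ^ k + u * B ^ k) = A ^ k + B ^ k := by
      calc _ = (u + v) * (A ^ k + B ^ k) := by ring
        _ = _ := by rw [huv, one_mul]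
    linarith

lemma cosh_norm_aux {E : Type*} [NormedAddCommGroup E] [InnerProductSpace ℝ E] (x y : E) :
    Real.cosh ‖x + y‖ + Real.cosh ‖x - y‖ ≤ 2 * (Real.cosh ‖x‖ * Real.cosh ‖y‖) := by
  have e : 2 * (Real.cosh ‖x‖ * Real.cosh ‖y‖)
      = Real.cosh (‖x‖ - ‖y‖) + Real.cosh (‖x‖ + ‖y‖) := by
    rw [Real.cosh_add, Real.cosh_sub]; ring
  rw [e]
  refine hasSum_le (fun k => ?_) ((Real.hasSum_cosh _).add (Real.hasSum_cosh _))
    ((Real.hasSum_cosh _).add (Real.hasSum_cosh _))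
  rw [← add_div, ← add_div]
  apply div_le_div_of_nonneg_right _ (by positivity)
  simp only [pow_mul]
  apply pow_add_pow_le_aux (sq_nonneg _)
  · apply sq_le_sq.2
    rw [abs_of_nonneg (norm_nonneg (x + y))]
    have := abs_norm_sub_norm_le x (-y)
    simpa using this
  · exact pow_le_pow_left₀ (norm_nonneg _) (norm_add_le x y) 2
  · have := parallelogram_law_with_norm ℝ x y
    nlinarith

def flipT {T N : ℕ} (t : Fin T) (i : Fin N) (σ : Fin T → Fin N → Bool) : Fin T → Fin N → Bool :=
  fun t' i' => if t' = t ∧ i' = i then !(σ t' i') else σ t' i'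

lemma flipT_invol {T N : ℕ} (t : Fin T) (i : Fin N) :
    Function.Involutive (flipT (T := T) (N := N) t i) := by
  intro σ
  funext t' i'
  by_cases h : t' = t ∧ i' = i <;> simp [flipT, h]

lemma sgn_not (b : Bool) : sgn (!b) = - sgn b := by cases b <;> simp [sgn]

lemma sgn_abs (b : Bool) : |sgn b| = 1 := by cases b <;> simp [sgn]

lemma cosh_sum_aux {E : Type*} [NormedAddCommGroup E] [InnerProductSpace ℝ E] {T N : ℕ}
    (t : Fin T) (φ : Fin N → E) (S : Finset (Fin N)) :
    ∑ σ : Fin T → Fin N → Bool, Real.cosh ‖∑ i ∈ S, sgn (σ t i) • φ i‖ ≤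
      (Fintype.card (Fin T → Fin N → Bool) : ℝ) * ∏ i ∈ S, Real.cosh ‖φ i‖ := by
  classical
  induction S using Finset.induction_on with
  | empty => simp
  | insert a S ha ih =>
    rw [Finset.prod_insert ha]
    have hflip : ∑ σ : Fin T → Fin N → Bool, Real.cosh ‖∑ i ∈ insert a S, sgn (σ t i) • φ i‖
        = ∑ σ : Fin T → Fin N → Bool,
            Real.cosh ‖∑ i ∈ insert a S, sgn (flipT t a σ t i) • φ i‖ :=
      (Equiv.sum_comp (flipT_invol t a).toPerm
        (fun σ : Fin T → Fin N → Bool =>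
          Real.cosh ‖∑ i ∈ insert a S, sgn (σ t i) • φ i‖)).symm
    have key : ∀ σ : Fin T → Fin N → Bool,
        Real.cosh ‖∑ i ∈ insert a S, sgn (σ t i) • φ i‖ +
          Real.cosh ‖∑ i ∈ insert a S, sgn (flipT t a σ t i) • φ i‖ ≤
        2 * Real.cosh ‖φ a‖ * Real.cosh ‖∑ i ∈ S, sgn (σ t i) • φ i‖ := by
      intro σ
      rw [Finset.sum_insert ha, Finset.sum_insert ha]
      have e1 : ∑ i ∈ S, sgn (flipT t a σ t i) • φ i = ∑ i ∈ S, sgn (σ t i) • φ i := by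
        apply Finset.sum_congr rfl
        intro i hi
        have : i ≠ a := fun h => ha (h ▸ hi)
        simp [flipT, this]
      have e2 : sgn (flipT t a σ t a) = - sgn (σ t a) := by
        simp [flipT, sgn_not]
      rw [e1, e2]
      have := cosh_norm_aux (∑ i ∈ S, sgn (σ t i) • φ i) (sgn (σ t a) • φ a)
      rw [norm_smul, Real.norm_eq_abs, sgn_abs, one_mul] at this
      rw [add_comm (sgn (σ t a) • φ a), neg_smul, add_comm (- (sgn (σ t a) • φ a)),
        ← sub_eq_add_neg]
      linarith
    have h2 := Finset.sum_le_sum (s := Finset.univ) (fun σ _ => key σ)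
    rw [Finset.sum_add_distrib, ← hflip, ← Finset.mul_sum] at h2
    have h3 := mul_le_mul_of_nonneg_left ih (Real.cosh_pos ‖φ a‖).le
    linarith

lemma rpow_le_cosh_aux {p s x : ℝ} (hp : 0 < p) (hs : 0 < s) (hx : 0 ≤ x) :
    x ^ p ≤ 2 * (p / (Real.exp 1 * s)) ^ p * Real.cosh (s * x) := by
  have h1 : s * x / p ≤ Real.exp (s * x / p - 1) := by
    have := Real.add_one_le_exp (s * x / p - 1); linarith
  have h2 : x ≤ p / (Real.exp 1 * s) * Real.exp (s * x / p) := by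
    rw [Real.exp_sub] at h1
    have : x = p / s * (s * x / p) := by field_simp
    calc x = p / s * (s * x / p) := this
      _ ≤ p / s * (Real.exp (s * x / p) / Real.exp 1) := by gcongr
      _ = _ := by field_simp
  have h3 : Real.exp (s * x) ≤ 2 * Real.cosh (s * x) := by
    rw [Real.cosh_eq]; have := Real.exp_pos (-(s * x)); linarith
  calc x ^ p ≤ (p / (Real.exp 1 * s) * Real.exp (s * x / p)) ^ p := by gcongr
    _ = (p / (Real.exp 1 * s)) ^ p * Real.exp (s * x) := by
      rw [Real.mul_rpow (by positivity) (by positivity), ← Real.exp_mul]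
      congr 2; field_simp
    _ ≤ (p / (Real.exp 1 * s)) ^ p * (2 * Real.cosh (s * x)) := by gcongr
    _ = _ := by ring

lemma moment_aux {E : Type*} [NormedAddCommGroup E] [InnerProductSpace ℝ E] {T N : ℕ} (hN : 0 < N)
    (t : Fin T) (φ : Fin N → E) (hφ : ∀ i, ‖φ i‖ ≤ 1) {p : ℝ} (hp : 0 < p) :
    ∑ σ : Fin T → Fin N → Bool, ‖∑ i, sgn (σ t i) • φ i‖ ^ p ≤
      (Fintype.card (Fin T → Fin N → Bool) : ℝ) *
        (2 * (Real.sqrt (p * N) * Real.exp (-(1/2))) ^ p) := by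
  have hN' : (0 : ℝ) < N := by exact_mod_cast hN
  set s := Real.sqrt (p / N) with hs
  have hs0 : 0 < s := Real.sqrt_pos.2 (by positivity)
  have hs2 : s ^ 2 = p / N := Real.sq_sqrt (by positivity)
  have hc := cosh_sum_aux t (fun i => s • φ i) Finset.univ
  have hprod : ∏ i : Fin N, Real.cosh ‖s • φ i‖ ≤ Real.exp (p / 2) := by
    calc ∏ i : Fin N, Real.cosh ‖s • φ i‖ ≤ ∏ i : Fin N, Real.exp (s ^ 2 / 2) := by
          apply Finset.prod_le_prod
          · intro i _; exact (Real.cosh_pos _).le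
          · intro i _
            refine (Real.cosh_le_exp_half_sq _).trans (Real.exp_le_exp.2 ?_)
            rw [norm_smul, Real.norm_eq_abs, abs_of_pos hs0]
            have : s * ‖φ i‖ ≤ s := by
              have := mul_le_mul_of_nonneg_left (hφ i) hs0.le
              linarith
            gcongr
      _ = Real.exp (p / 2) := by
          rw [Finset.prod_const, ← Real.exp_nat_mul]
          congr 1
          rw [hs2]; simp; field_simp
  have hk : ∀ σ : Fin T → Fin N → Bool, ‖∑ i, sgn (σ t i) • φ i‖ ^ p ≤
      2 * (p / (Real.exp 1 * s)) ^ p * Real.cosh ‖∑ i, sgn (σ t i) • s • φ i‖ := by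
    intro σ
    have e : ‖∑ i, sgn (σ t i) • s • φ i‖ = s * ‖∑ i, sgn (σ t i) • φ i‖ := by
      simp_rw [smul_comm _ s]
      rw [← Finset.smul_sum, norm_smul, Real.norm_eq_abs, abs_of_pos hs0]
    rw [e]
    exact rpow_le_cosh_aux hp hs0 (norm_nonneg _)
  have hsum := Finset.sum_le_sum (s := Finset.univ) (fun σ _ => hk σ)
  rw [← Finset.mul_sum] at hsum
  have hps : p / (Real.exp 1 * s) = Real.sqrt (p * N) * Real.exp (-1) := by
    rw [Real.exp_neg]
    have : p = Real.sqrt (p * N) * s := by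
      rw [hs, ← Real.sqrt_mul (by positivity)]
      rw [show p * N * (p / N) = p ^ 2 by field_simp, Real.sqrt_sq hp.le]
    field_simp
    linarith [this]
  refine hsum.trans ?_
  calc _ ≤ 2 * (p / (Real.exp 1 * s)) ^ p *
        ((Fintype.card (Fin T → Fin N → Bool) : ℝ) * Real.exp (p / 2)) := by
        gcongr
        exact hc.trans (by gcongr)
    _ = _ := by
      rw [hps, Real.mul_rpow (by positivity) (by positivity),
        Real.mul_rpow (by positivity) (by positivity), ← Real.exp_mul, ← Real.exp_mul]
      have : Real.exp (-(1/2) * p) = Real.exp (-1 * p) * Real.exp (p / 2) := by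
        rw [← Real.exp_add]; congr 1; ring
      rw [this]; ring

lemma jensen_aux {T N : ℕ} (f : (Fin T → Fin N → Bool) → ℝ) (hf : ∀ σ, 0 ≤ f σ) {p : ℝ}
    (hp : 1 ≤ p) {K : ℝ}
    (h : ∑ σ, f σ ≤ (Fintype.card (Fin T → Fin N → Bool) : ℝ) * K) :
    Eσ T N (fun σ => f σ ^ (1 / p)) ≤ K ^ (1 / p) := by
  have hc : (0 : ℝ) < (Fintype.card (Fin T → Fin N → Bool) : ℝ) := by
    exact_mod_cast Fintype.card_pos
  have hp0 : 0 < p := by linarith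
  have hJ := Real.rpow_arith_mean_le_arith_mean_rpow Finset.univ
    (fun _ : Fin T → Fin N → Bool => ((Fintype.card (Fin T → Fin N → Bool) : ℝ))⁻¹)
    (fun σ => f σ ^ (1 / p)) (fun _ _ => by positivity)
    (by rw [Finset.sum_const, nsmul_eq_mul, Finset.card_univ, mul_inv_cancel₀ hc.ne'])
    (fun σ _ => Real.rpow_nonneg (hf σ) _) hp
  rw [← Finset.mul_sum, ← Finset.mul_sum] at hJ
  have e : ∀ σ, (f σ ^ (1 / p)) ^ p = f σ := by
    intro σ
    rw [← Real.rpow_mul (hf σ), one_div, inv_mul_cancel₀ hp0.ne', Real.rpow_one]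
  simp_rw [e] at hJ
  have h0 : 0 ≤ Eσ T N (fun σ => f σ ^ (1 / p)) :=
    div_nonneg (Finset.sum_nonneg fun σ _ => Real.rpow_nonneg (hf σ) _) hc.le
  have h1 : Eσ T N (fun σ => f σ ^ (1 / p)) ^ p ≤ K := by
    unfold Eσ
    rw [div_eq_inv_mul]
    refine hJ.trans ?_
    rw [inv_mul_le_iff₀ hc]
    exact h
  have h2 := Real.rpow_le_rpow (Real.rpow_nonneg h0 p) h1 (z := 1 / p) (by positivity)
  rwa [← Real.rpow_mul h0, mul_one_div_cancel hp0.ne', Real.rpow_one] at h2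

/-- The vector `u_{m,t}`. -/
def uvec {M : ℕ} {H : Fin M → Type*} [∀ m, NormedAddCommGroup (H m)]
    [∀ m, InnerProductSpace ℝ (H m)] {T N : ℕ}
    (φ : ∀ m, Fin T → Fin N → H m) (σ : Fin T → Fin N → Bool) (m : Fin M) (t : Fin T) : H m :=
  ∑ i, sgn (σ t i) • φ m t i

lemma obj_aux {M : ℕ} {H : Fin M → Type*} [∀ m, NormedAddCommGroup (H m)]
    [∀ m, InnerProductSpace ℝ (H m)] {T N : ℕ}
    (φ : ∀ m, Fin T → Fin N → H m) (σ : Fin T → Fin N → Bool) {s r R : ℝ}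
    {w : Fin T → ∀ m, H m} {θ : Fin M → ℝ} {lam : Fin T → ℝ} (h : MKadm H s r R w θ lam) :
    ∑ t, ∑ i, sgn (σ t i) * ∑ m, Real.sqrt (θ m) * ⟪w t m, φ m t i⟫ ≤
      Real.sqrt R * ∑ t, lam t * Real.sqrt (∑ m, θ m * ‖uvec φ σ m t‖ ^ 2) := by
  obtain ⟨hθ, -, hl, -, hw⟩ := h
  rw [Finset.mul_sum]
  apply Finset.sum_le_sum
  intro t _
  have e : ∑ i, sgn (σ t i) * ∑ m, Real.sqrt (θ m) * ⟪w t m, φ m t i⟫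
      = ∑ m, Real.sqrt (θ m) * ⟪w t m, uvec φ σ m t⟫ := by
    simp_rw [Finset.mul_sum]
    rw [Finset.sum_comm]
    apply Finset.sum_congr rfl
    intro m _
    rw [uvec, inner_sum, Finset.mul_sum]
    apply Finset.sum_congr rfl
    intro i _
    rw [inner_smul_right]; ring
  rw [e]
  calc ∑ m, Real.sqrt (θ m) * ⟪w t m, uvec φ σ m t⟫
      ≤ ∑ m, ‖w t m‖ * (Real.sqrt (θ m) * ‖uvec φ σ m t‖) := by
        apply Finset.sum_le_sum
        intro m _
        have := mul_le_mul_of_nonneg_left (real_inner_le_norm (w t m) (uvec φ σ m t))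
          (Real.sqrt_nonneg (θ m))
        linarith
    _ ≤ Real.sqrt (∑ m, ‖w t m‖ ^ 2) * Real.sqrt (∑ m, (Real.sqrt (θ m) * ‖uvec φ σ m t‖) ^ 2) :=
        Real.sum_mul_le_sqrt_mul_sqrt _ _ _
    _ ≤ (lam t * Real.sqrt R) * Real.sqrt (∑ m, θ m * ‖uvec φ σ m t‖ ^ 2) := by
        apply mul_le_mul _ _ (Real.sqrt_nonneg _) (mul_nonneg (hl t) (Real.sqrt_nonneg _))
        · refine (Real.sqrt_le_sqrt (hw t)).trans ?_
          rw [Real.sqrt_mul (sq_nonneg _), Real.sqrt_sq (hl t)]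
        · apply le_of_eq
          congr 1
          apply Finset.sum_congr rfl
          intro m _
          rw [mul_pow, Real.sq_sqrt (hθ m)]
    _ = _ := by ring

lemma core_aux {M : ℕ} (H : Fin M → Type*) [∀ m, NormedAddCommGroup (H m)]
    [∀ m, InnerProductSpace ℝ (H m)] (T N : ℕ) (hN : 0 < N)
    (φ : ∀ m, Fin T → Fin N → H m) (hφ : ∀ m t i, ‖φ m t i‖ ≤ 1) (s r R p : ℝ) (hp : 1 ≤ p)
    (h : ∀ σ w θ lam, MKadm H s r R w θ lam →
      ∑ t, lam t * Real.sqrt (∑ m, θ m * ‖uvec φ σ m t‖ ^ 2) ≤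
        (∑ t, ∑ m, ‖uvec φ σ m t‖ ^ p) ^ (1 / p)) :
    ERCmk H T N φ s r R ≤ (2 / ((T : ℝ) * N)) * (Real.sqrt R *
      ((2 * ((M : ℝ) * T)) ^ (1 / p) * (Real.sqrt (p * N) * Real.exp (-(1/2))))) := by
  have hp0 : 0 < p := by linarith
  have hJ := jensen_aux (T := T) (N := N) (fun σ => ∑ t, ∑ m, ‖uvec φ σ m t‖ ^ p)
    (fun σ => by positivity) hp
    (K := (2 * ((M : ℝ) * T)) * (Real.sqrt (p * N) * Real.exp (-(1/2))) ^ p) (by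
      rw [Finset.sum_comm]
      simp_rw [Finset.sum_comm (s := (Finset.univ : Finset (Fin T → Fin N → Bool)))]
      calc _ ≤ ∑ t : Fin T, ∑ m : Fin M, (Fintype.card (Fin T → Fin N → Bool) : ℝ) *
            (2 * (Real.sqrt (p * N) * Real.exp (-(1/2))) ^ p) :=
            Finset.sum_le_sum fun t _ => Finset.sum_le_sum fun m _ =>
              moment_aux hN t (φ m t) (hφ m t) hp0
        _ = _ := by
          simp only [Finset.sum_const, Finset.card_univ, Fintype.card_fin, nsmul_eq_mul]
          ring)
  rw [Real.mul_rpow (by positivity) (by positivity), ← Real.rpow_mul (by positivity),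
    mul_one_div_cancel hp0.ne', Real.rpow_one] at hJ
  refine le_trans ?_ (mul_le_mul_of_nonneg_left (mul_le_mul_of_nonneg_left hJ
    (Real.sqrt_nonneg R)) (by positivity))
  unfold ERCmk Eσ
  rw [← mul_div_assoc, ← mul_div_assoc, Finset.mul_sum, Finset.mul_sum]
  apply div_le_div_of_nonneg_right _ (by positivity)
  apply Finset.sum_le_sum
  intro σ _
  apply Real.sSup_le
  · rintro v ⟨w, θ, lam, hadm, rfl⟩
    apply mul_le_mul_of_nonneg_left _ (by positivity)
    exact (obj_aux φ σ hadm).trans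
      (mul_le_mul_of_nonneg_left (h σ w θ lam hadm) (Real.sqrt_nonneg R))
  · positivity

lemma le_one_of_sum_rpow {ι : Type*} [Fintype ι] {θ : ι → ℝ} {r : ℝ} (hr : 0 < r)
    (h0 : ∀ m, 0 ≤ θ m) (h : ∑ m, θ m ^ r ≤ 1) (m : ι) : θ m ≤ 1 := by
  have h1 : θ m ^ r ≤ 1 :=
    (Finset.single_le_sum (f := fun m => θ m ^ r)
      (fun i _ => Real.rpow_nonneg (h0 i) r) (Finset.mem_univ m)).trans h
  by_contra hc
  push Not at hc
  exact absurd h1 (not_le.2 (Real.one_lt_rpow hc hr))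

lemma lam_holder {T : ℕ} {p : ℝ} (hp : 1 < p) {lam A : Fin T → ℝ} (hl : ∀ t, 0 ≤ lam t)
    (hs : ∑ t, lam t ^ (p / (p - 1)) ≤ 1) (hA : ∀ t, 0 ≤ A t) :
    ∑ t, lam t * A t ≤ (∑ t, A t ^ p) ^ (1 / p) := by
  have hpq : (p / (p - 1)).HolderConjugate p := (Real.HolderConjugate.conjExponent hp).symm
  refine (Real.inner_le_Lp_mul_Lq_of_nonneg Finset.univ hpq (fun t _ => hl t)
    (fun t _ => hA t)).trans ?_
  have h0 : 0 ≤ ∑ t, lam t ^ (p / (p - 1)) := Finset.sum_nonneg fun t _ => Real.rpow_nonneg (hl t) _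
  have : (∑ t, lam t ^ (p / (p - 1))) ^ (1 / (p / (p - 1))) ≤ 1 :=
    Real.rpow_le_one h0 hs (by have := hpq.pos; positivity)
  exact mul_le_of_le_one_left (Real.rpow_nonneg (Finset.sum_nonneg fun t _ =>
    Real.rpow_nonneg (hA t) _) _) this

/-- `ℓ_r` bound on the kernel weights. -/
lemma theta_holder {M : ℕ} {L r : ℝ} (hL : 1 < L) (hr : 1 ≤ r) (hrL : r ≤ L / (L - 1))
    {θ a : Fin M → ℝ} (h0 : ∀ m, 0 ≤ θ m) (h : ∑ m, θ m ^ r ≤ 1) (ha : ∀ m, 0 ≤ a m) :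
    Real.sqrt (∑ m, θ m * a m ^ 2) ^ (2 * L) ≤ ∑ m, a m ^ (2 * L) := by
  have h1 := le_one_of_sum_rpow (by linarith) h0 h
  have h2 : ∑ m, θ m ^ (L / (L - 1)) ≤ 1 := by
    refine le_trans (Finset.sum_le_sum fun m _ => ?_) h
    rcases eq_or_lt_of_le (h0 m) with hm | hm
    · rw [← hm, Real.zero_rpow (by linarith), Real.zero_rpow (by linarith)]
    · exact Real.rpow_le_rpow_of_exponent_ge hm (h1 m) hrL
  have h3 := lam_holder hL h0 h2 (A := fun m => a m ^ 2) (fun m => sq_nonneg _)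
  have hS : 0 ≤ ∑ m, θ m * a m ^ 2 := Finset.sum_nonneg fun m _ => mul_nonneg (h0 m) (sq_nonneg _)
  have e : ∀ m, (a m ^ 2) ^ L = a m ^ (2 * L) := by
    intro m; rw [Real.rpow_mul (ha m), Real.rpow_two]
  simp_rw [e] at h3
  rw [Real.rpow_mul (Real.sqrt_nonneg _), Real.rpow_two, Real.sq_sqrt hS]
  have h4 := Real.rpow_le_rpow hS h3 (z := L) (by linarith)
  rwa [← Real.rpow_mul (Finset.sum_nonneg fun m _ => Real.rpow_nonneg (ha m) _),
    one_div_mul_cancel (by linarith), Real.rpow_one] at h4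

/-- Suppose `‖φ_{m,t}^i‖ ≤ 1` for all `m, t, i`, `MT ≥ 2`, and
`r ≥ 1` satisfies `r* ≥ log(MT)` (with `r* = ∞` when `r = 1`).  With `ρ = 2 log(MT)`
and `ρ* = ρ/(ρ-1)`: `R̂(F_{ρ*,r}) ≤ (2/(T√N)) √( 2 e R log(MT) )`. -/
theorem ercmk_rhoStar_bound {M : ℕ} (H : Fin M → Type*)
    [∀ m, NormedAddCommGroup (H m)] [∀ m, InnerProductSpace ℝ (H m)]
    (T N : ℕ) (hN : 0 < N) (hM : 0 < M) (hMT : 2 ≤ M * T) (R : ℝ) (hR : 0 < R)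
    (φ : ∀ m, Fin T → Fin N → H m) (hφ : ∀ m t i, ‖φ m t i‖ ≤ 1)
    (r : ℝ) (hr : 1 ≤ r)
    (hrstar : r = 1 ∨ (1 < r ∧ Real.log ((M : ℝ) * T) ≤ r / (r - 1)))
    (ρ : ℝ) (hρ : ρ = 2 * Real.log ((M : ℝ) * T)) :
    ERCmk H T N φ (ρ / (ρ - 1)) r R ≤
      (2 / ((T : ℝ) * Real.sqrt N)) *
        Real.sqrt (2 * Real.exp 1 * R * Real.log ((M : ℝ) * T)) := by
  have hMT' : (2 : ℝ) ≤ (M : ℝ) * T := by exact_mod_cast hMT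
  have hN' : (0 : ℝ) < N := by exact_mod_cast hN
  have hT : 0 < T := Nat.pos_of_ne_zero (by rintro rfl; simp at hMT)
  have hT' : (0 : ℝ) < T := by exact_mod_cast hT
  set L := Real.log ((M : ℝ) * T) with hL
  have hlog2 : 0.69 < Real.log 2 := by have := Real.log_two_gt_d9; linarith
  have hL2 : Real.log 2 ≤ L := Real.log_le_log (by norm_num) hMT'
  have hρ1 : 1 < ρ := by rw [hρ]; linarith
  -- rewriting the target
  have final : ∀ B : ℝ, B ≤ Real.sqrt (2 * Real.exp 1 * L * N) →
      (2 / ((T : ℝ) * N)) * (Real.sqrt R * B) ≤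
      (2 / ((T : ℝ) * Real.sqrt N)) * Real.sqrt (2 * Real.exp 1 * R * L) := by
    intro B hB
    calc _ ≤ (2 / ((T : ℝ) * N)) * (Real.sqrt R * Real.sqrt (2 * Real.exp 1 * L * N)) := by gcongr
      _ = _ := by
        have hL0 : 0 ≤ L := by linarith
        rw [← Real.sqrt_mul hR.le,
          show R * (2 * Real.exp 1 * L * N) = (2 * Real.exp 1 * R * L) * N by ring,
          Real.sqrt_mul (by positivity)]
        have hs : Real.sqrt N ≠ 0 := (Real.sqrt_pos.2 hN').ne'
        have : (N : ℝ) = Real.sqrt N * Real.sqrt N := (Real.mul_self_sqrt hN'.le).symm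
        field_simp
        rw [Real.sq_sqrt hN'.le, mul_comm]
  have main : (∀ (a θ : Fin M → ℝ), (∀ m, 0 ≤ a m) → (∀ m, 0 ≤ θ m) → ∑ m, θ m ^ r ≤ 1 →
      Real.sqrt (∑ m, θ m * a m ^ 2) ^ ρ ≤ ∑ m, a m ^ ρ) →
      ERCmk H T N φ (ρ / (ρ - 1)) r R ≤
      (2 / ((T : ℝ) * Real.sqrt N)) * Real.sqrt (2 * Real.exp 1 * R * L) := by
    intro hmain
    refine (core_aux H T N hN φ hφ _ r R ρ hρ1.le ?_).trans (final _ ?_)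
    · intro σ w θ lam hadm
      obtain ⟨hθ, hθr, hl, hls, -⟩ := hadm
      refine (lam_holder hρ1 hl hls (fun t => Real.sqrt_nonneg _)).trans ?_
      apply Real.rpow_le_rpow (Finset.sum_nonneg fun t _ => Real.rpow_nonneg (Real.sqrt_nonneg _) _)
        _ (by positivity)
      exact Finset.sum_le_sum fun t _ => hmain _ θ (fun m => norm_nonneg _) hθ hθr
    · have h1 : (2 * ((M : ℝ) * T)) ^ (1 / ρ) ≤ Real.exp 1 := by
        have e : (M : ℝ) * T = Real.exp L := (Real.exp_log (by linarith)).symm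
        calc (2 * ((M : ℝ) * T)) ^ (1 / ρ) ≤ (Real.exp ρ) ^ (1 / ρ) := by
              apply Real.rpow_le_rpow (by positivity) _ (by positivity)
              rw [hρ, two_mul L, Real.exp_add, ← e]
              gcongr
          _ = Real.exp 1 := by
              rw [← Real.exp_mul, mul_one_div_cancel (by linarith)]
      calc _ ≤ Real.exp 1 * (Real.sqrt (ρ * N) * Real.exp (-(1/2))) := by gcongr
        _ = Real.sqrt (2 * Real.exp 1 * L * N) := by
          rw [show 2 * Real.exp 1 * L * N = (ρ * N) * Real.exp 1 by rw [hρ]; ring,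
            Real.sqrt_mul (show 0 ≤ ρ * (N : ℝ) by positivity), ← Real.exp_half]
          have : Real.exp 1 * Real.exp (-(1/2)) = Real.exp (1 / 2) := by
            rw [← Real.exp_add]; norm_num
          rw [← this]; ring
  by_cases hM1 : M = 1
  · subst hM1
    apply main
    intro a θ ha hθ hθr
    have h1 := le_one_of_sum_rpow (by linarith) hθ hθr
    simp only [Fin.sum_univ_one]
    apply Real.rpow_le_rpow (Real.sqrt_nonneg _) _ (by linarith)
    apply Real.sqrt_le_iff.2 ⟨ha 0, ?_⟩
    exact mul_le_of_le_one_left (sq_nonneg _) (h1 0)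
  by_cases h3 : 3 ≤ M * T
  · have h3' : (3 : ℝ) ≤ (M : ℝ) * T := by exact_mod_cast h3
    have hL1 : 1 < L := by
      rw [hL, Real.lt_log_iff_exp_lt (by linarith)]
      have := Real.exp_one_lt_d9
      linarith
    apply main
    intro a θ ha hθ hθr
    rw [hρ]
    refine theta_holder hL1 hr ?_ hθ hθr ha
    rw [le_div_iff₀ (by linarith)]
    rcases hrstar with h | ⟨h, h'⟩
    · rw [h]; linarith
    · rw [le_div_iff₀ (by linarith)] at h'
      linarith
  · have hMT2 : M * T = 2 := by omega
    have hM2 : M = 2 := by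
      have : M ≤ 2 := by
        rw [← hMT2]; exact Nat.le_mul_of_pos_right _ hT
      omega
    have hT1 : T = 1 := by subst hM2; omega
    subst hM2
    subst hT1
    refine (core_aux H 1 N hN φ hφ _ r R 2 (by norm_num) ?_).trans (final _ ?_)
    · intro σ w θ lam hadm
      obtain ⟨hθ, hθr, hl, hls, -⟩ := hadm
      have h1 := le_one_of_sum_rpow (by linarith) hθ hθr
      have h2 := le_one_of_sum_rpow (div_pos (by linarith) (by linarith)) hl hls
      rw [Fin.sum_univ_one, Fin.sum_univ_one, ← Real.sqrt_eq_rpow]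
      refine (mul_le_of_le_one_left (Real.sqrt_nonneg _) (h2 0)).trans ?_
      apply Real.sqrt_le_sqrt
      apply Finset.sum_le_sum
      intro m _
      rw [Real.rpow_two]
      exact mul_le_of_le_one_left (sq_nonneg _) (h1 m)
    · have e4 : (2 * (((2 : ℕ) : ℝ) * ((1 : ℕ) : ℝ))) ^ (1 / (2 : ℝ)) = Real.sqrt 4 := by
        rw [← Real.sqrt_eq_rpow]; norm_num
      rw [e4]
      apply Real.le_sqrt_of_sq_le
      rw [mul_pow, mul_pow, Real.sq_sqrt (by norm_num), Real.sq_sqrt (by positivity),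
        ← Real.exp_nat_mul]
      have he : Real.exp ((2 : ℕ) * (-(1/2))) * Real.exp 1 = 1 := by
        rw [← Real.exp_add]; norm_num
      have he1 : 2.7 < Real.exp 1 := by have := Real.exp_one_gt_d9; linarith
      have hle : Real.exp ((2 : ℕ) * (-(1/2))) ≤ 0.4 := by
        by_contra hc
        push Not at hc
        nlinarith
      have : 1.6 ≤ Real.exp 1 * L := by nlinarith
      nlinarith

end
end
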